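/- arXiv:2412.16353 — 2 statements merged into one kernel-verified Lean document; each statement's English description precedes it below -/
import Mathlib

section
/- Fix g > 0. Define E₁(U) = ½(qˣ·u + qʸ·v) + ½g‖h‖², H₁(U) = ½(uᵀ𝒫(qˣ)u + vᵀ𝒫(qˣ)v) + g qˣ·h and K₁(U) = ½(uᵀ𝒫(qʸ)u + vᵀ𝒫(qʸ)v) + g qʸ·h, where u = 𝒫(h)⁻¹qˣ and v = 𝒫(h)⁻¹qʸ. Then for every state U with 𝒫(h) invertible, the Fréchet derivatives satisfy the compatibility identities DH₁(U) = DE₁(U) ∘ J_F(U) and DK₁(U) = DE₁(U) ∘ J_G(U) as linear maps ℝ^{3K} → ℝ, where J_F(U) = [[0, I, 0], [g𝒫(h) − 𝒫(qˣ)𝒫(h)⁻¹𝒫(u), 𝒫(qˣ)𝒫(h)⁻¹ + 𝒫(u), 0], [−𝒫(qˣ)𝒫(h)⁻¹𝒫(v), 𝒫(v), 𝒫(qˣ)𝒫(h)⁻¹]] and J_G(U) = [[0, 0, I], [−𝒫(qʸ)𝒫(h)⁻¹𝒫(u), 𝒫(qʸ)𝒫(h)⁻¹, 𝒫(u)], [g𝒫(h)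 − 𝒫(qʸ)𝒫(h)⁻¹𝒫(v), 0, 𝒫(qʸ)𝒫(h)⁻¹ + 𝒫(v)]]. -/
open Matrix

/-- The Galerkin triple-product matrix `𝒫(a)`, defined by
`(𝒫(a))_{l,m} = ∑ k, a k * T k l m`. -/
noncomputable def Pmat {K : ℕ} (T : Fin K → Fin K → Fin K → ℝ) (a : Fin K → ℝ) :
    Matrix (Fin K) (Fin K) ℝ :=
  Matrix.of fun l m => ∑ k, a k * T k l m

/-- A state `U = (h, qˣ, qʸ) ∈ ℝ^K × ℝ^K × ℝ^K`. -/
abbrev StateK (K : ℕ) := (Fin K → ℝ) × (Fin K → ℝ) × (Fin K → ℝ)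

/-- `E₁(U) = ½(qˣ·u + qʸ·v) + ½g‖h‖²`, `u = 𝒫(h)⁻¹qˣ`, `v = 𝒫(h)⁻¹qʸ`. -/
noncomputable def E1 {K : ℕ} (T : Fin K → Fin K → Fin K → ℝ) (g : ℝ)
    (U : StateK K) : ℝ :=
  (1 / 2) * (U.2.1 ⬝ᵥ ((Pmat T U.1)⁻¹ *ᵥ U.2.1) + U.2.2 ⬝ᵥ ((Pmat T U.1)⁻¹ *ᵥ U.2.2))
    + (1 / 2) * g * (U.1 ⬝ᵥ U.1)

/-- `H₁(U) = ½(uᵀ𝒫(qˣ)u + vᵀ𝒫(qˣ)v) + g qˣ·h`. -/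
noncomputable def H1 {K : ℕ} (T : Fin K → Fin K → Fin K → ℝ) (g : ℝ)
    (U : StateK K) : ℝ :=
  (1 / 2) * (((Pmat T U.1)⁻¹ *ᵥ U.2.1) ⬝ᵥ (Pmat T U.2.1 *ᵥ ((Pmat T U.1)⁻¹ *ᵥ U.2.1))
      + ((Pmat T U.1)⁻¹ *ᵥ U.2.2) ⬝ᵥ (Pmat T U.2.1 *ᵥ ((Pmat T U.1)⁻¹ *ᵥ U.2.2)))
    + g * (U.2.1 ⬝ᵥ U.1)

/-- `K₁(U) = ½(uᵀ𝒫(qʸ)u + vᵀ𝒫(qʸ)v) + g qʸ·h`. -/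
noncomputable def K1 {K : ℕ} (T : Fin K → Fin K → Fin K → ℝ) (g : ℝ)
    (U : StateK K) : ℝ :=
  (1 / 2) * (((Pmat T U.1)⁻¹ *ᵥ U.2.1) ⬝ᵥ (Pmat T U.2.2 *ᵥ ((Pmat T U.1)⁻¹ *ᵥ U.2.1))
      + ((Pmat T U.1)⁻¹ *ᵥ U.2.2) ⬝ᵥ (Pmat T U.2.2 *ᵥ ((Pmat T U.1)⁻¹ *ᵥ U.2.2)))
    + g * (U.2.2 ⬝ᵥ U.1)

/-- Product rule for a bilinear map between finite-dimensional spaces. -/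
theorem exists_hasFDerivAt_bilinear {X E F G : Type*}
    [NormedAddCommGroup X] [NormedSpace ℝ X]
    [NormedAddCommGroup E] [NormedSpace ℝ E] [FiniteDimensional ℝ E]
    [NormedAddCommGroup F] [NormedSpace ℝ F] [FiniteDimensional ℝ F]
    [NormedAddCommGroup G] [NormedSpace ℝ G]
    (B : E →ₗ[ℝ] F →ₗ[ℝ] G) {a : X → E} {b : X → F} {A : X →L[ℝ] E} {A' : X →L[ℝ] F} {x : X}
    (ha : HasFDerivAt a A x) (hb : HasFDerivAt b A' x) :
    ∃ D : X →L[ℝ] G, HasFDerivAt (fun y => B (a y) (b y)) D x ∧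
      ∀ δ, D δ = B (A δ) (b x) + B (a x) (A' δ) := by
  refine ⟨_, (LinearMap.toContinuousBilinearMap B).hasFDerivAt_of_bilinear ha hb, fun δ => ?_⟩
  simp [add_comm]

section

variable {K : ℕ} (T : Fin K → Fin K → Fin K → ℝ)

/-- `a ↦ 𝒫(a)` as a linear map. -/
noncomputable def PmatLinear : (Fin K → ℝ) →ₗ[ℝ] Matrix (Fin K) (Fin K) ℝ where
  toFun := Pmat T
  map_add' a b := by
    ext l m
    simp [Pmat, add_mul, Finset.sum_add_distrib]
  map_smul' c a := by
    ext l m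
    simp [Pmat, mul_assoc, Finset.mul_sum]

variable {T}

theorem Pmat_transpose (hT2 : ∀ k l m, T k l m = T k m l) (a : Fin K → ℝ) :
    (Pmat T a)ᵀ = Pmat T a := by
  ext l m
  simp [Pmat, fun k => hT2 k m l]

theorem Pmat_mulVec_comm (hT1 : ∀ k l m, T k l m = T l k m)
    (hT2 : ∀ k l m, T k l m = T k m l) (a b : Fin K → ℝ) :
    Pmat T a *ᵥ b = Pmat T b *ᵥ a := by
  ext l
  simp only [Pmat, mulVec, dotProduct, of_apply, Finset.sum_mul]
  rw [Finset.sum_comm]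
  refine Finset.sum_congr rfl fun k _ => Finset.sum_congr rfl fun m _ => ?_
  rw [hT2 k l m, hT1 k m l, hT2 m k l]
  ring

/-- A symmetric matrix is self-adjoint for the dot product. -/
theorem dotProduct_mulVec_of_transpose_eq {n : Type*} [Fintype n] {M : Matrix n n ℝ}
    (hM : Mᵀ = M) (a b : n → ℝ) : a ⬝ᵥ (M *ᵥ b) = (M *ᵥ a) ⬝ᵥ b := by
  rw [dotProduct_mulVec, ← mulVec_transpose, hM]

variable {X : Type*} [NormedAddCommGroup X] [NormedSpace ℝ X]

theorem exists_hasFDerivAt_dotProduct {n : Type*} [Fintype n] {a b : X → n → ℝ}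
    {A B : X →L[ℝ] n → ℝ} {x : X} (ha : HasFDerivAt a A x) (hb : HasFDerivAt b B x) :
    ∃ D : X →L[ℝ] ℝ, HasFDerivAt (fun y => a y ⬝ᵥ b y) D x ∧
      ∀ δ, D δ = A δ ⬝ᵥ b x + a x ⬝ᵥ B δ :=
  exists_hasFDerivAt_bilinear (dotProductBilin ℝ ℝ) ha hb

theorem exists_hasFDerivAt_Pmat_mulVec {a b : X → Fin K → ℝ} {A B : X →L[ℝ] Fin K → ℝ} {x : X}
    (ha : HasFDerivAt a A x) (hb : HasFDerivAt b B x) :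
    ∃ D : X →L[ℝ] Fin K → ℝ, HasFDerivAt (fun y => Pmat T (a y) *ᵥ b y) D x ∧
      ∀ δ, D δ = Pmat T (A δ) *ᵥ b x + Pmat T (a x) *ᵥ B δ :=
  exists_hasFDerivAt_bilinear (mulVecBilin ℝ ℝ ∘ₗ PmatLinear T) ha hb

open scoped Matrix.Norms.Operator in
/-- Derivative of `𝒫(h)⁻¹q`. -/
theorem exists_hasFDerivAt_inv_Pmat_mulVec {a b : X → Fin K → ℝ} {A B : X →L[ℝ] Fin K → ℝ}
    {x : X} (hinv : IsUnit (Pmat T (a x))) (ha : HasFDerivAt a A x) (hb : HasFDerivAt b B x) :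
    ∃ D : X →L[ℝ] Fin K → ℝ, HasFDerivAt (fun y => (Pmat T (a y))⁻¹ *ᵥ b y) D x ∧
      ∀ δ, D δ = (Pmat T (a x))⁻¹ *ᵥ (B δ - Pmat T (A δ) *ᵥ ((Pmat T (a x))⁻¹ *ᵥ b x)) := by
  obtain ⟨M, hM⟩ := hinv
  have hM' : (↑M⁻¹ : Matrix (Fin K) (Fin K) ℝ) = (Pmat T (a x))⁻¹ := by
    rw [← hM, coe_units_inv]
  have hP : HasFDerivAt (fun y => Pmat T (a y))
      ((LinearMap.toContinuousLinearMap (PmatLinear T)).comp A) x :=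
    (LinearMap.toContinuousLinearMap (PmatLinear T)).hasFDerivAt.comp x ha
  have hR := hasFDerivAt_ringInverse (𝕜 := ℝ) M
  rw [hM, hM'] at hR
  have hI := hR.comp x hP
  obtain ⟨D, hD, hDδ⟩ := exists_hasFDerivAt_bilinear (mulVecBilin ℝ ℝ) hI hb
  refine ⟨D, ?_, fun δ => ?_⟩
  · simpa only [nonsing_inv_eq_ringInverse] using! hD
  · rw [hDδ]
    change (-((Pmat T (a x))⁻¹ * Pmat T (A δ) * (Pmat T (a x))⁻¹)) *ᵥ b x +
      Ring.inverse (Pmat T (a x)) *ᵥ B δ = _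
    rw [← nonsing_inv_eq_ringInverse, neg_mulVec, mulVec_sub, mulVec_mulVec, mulVec_mulVec,
      mul_assoc]
    abel

/-- Derivative of the kinetic energy density `qᵀ𝒫(h)⁻¹q`. -/
theorem exists_hasFDerivAt_kinetic (hT2 : ∀ k l m, T k l m = T k m l)
    {a b : X → Fin K → ℝ} {A B : X →L[ℝ] Fin K → ℝ} {x : X} (hinv : IsUnit (Pmat T (a x)))
    (ha : HasFDerivAt a A x) (hb : HasFDerivAt b B x) :
    ∃ D : X →L[ℝ] ℝ, HasFDerivAt (fun y => b y ⬝ᵥ ((Pmat T (a y))⁻¹ *ᵥ b y)) D x ∧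
      ∀ δ, D δ = 2 * (((Pmat T (a x))⁻¹ *ᵥ b x) ⬝ᵥ B δ)
        - ((Pmat T (a x))⁻¹ *ᵥ b x) ⬝ᵥ (Pmat T (A δ) *ᵥ ((Pmat T (a x))⁻¹ *ᵥ b x)) := by
  obtain ⟨V, hV, hVδ⟩ := exists_hasFDerivAt_inv_Pmat_mulVec hinv ha hb
  obtain ⟨D, hD, hDδ⟩ := exists_hasFDerivAt_dotProduct hb hV
  refine ⟨D, hD, fun δ => ?_⟩
  have hs : ((Pmat T (a x))⁻¹)ᵀ = (Pmat T (a x))⁻¹ := by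
    rw [transpose_nonsing_inv, Pmat_transpose hT2]
  rw [hDδ, hVδ, dotProduct_mulVec_of_transpose_eq hs (b x), dotProduct_sub, dotProduct_comm (B δ)]
  ring

/-- Derivative of the kinetic flux density `uᵀ𝒫(p)u` with `u = 𝒫(h)⁻¹q`. -/
theorem exists_hasFDerivAt_kinetic_flux (hT2 : ∀ k l m, T k l m = T k m l)
    {a b p : X → Fin K → ℝ} {A B P : X →L[ℝ] Fin K → ℝ} {x : X} (hinv : IsUnit (Pmat T (a x)))
    (ha : HasFDerivAt a A x) (hb : HasFDerivAt b B x) (hp : HasFDerivAt p P x) :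
    ∃ D : X →L[ℝ] ℝ, HasFDerivAt (fun y => ((Pmat T (a y))⁻¹ *ᵥ b y) ⬝ᵥ
        (Pmat T (p y) *ᵥ ((Pmat T (a y))⁻¹ *ᵥ b y))) D x ∧
      ∀ δ, D δ = ((Pmat T (a x))⁻¹ *ᵥ b x) ⬝ᵥ (Pmat T (P δ) *ᵥ ((Pmat T (a x))⁻¹ *ᵥ b x))
        + 2 * (((Pmat T (a x))⁻¹ *ᵥ b x) ⬝ᵥ (Pmat T (p x) *ᵥ ((Pmat T (a x))⁻¹ *ᵥ
          (B δ - Pmat T (A δ) *ᵥ ((Pmat T (a x))⁻¹ *ᵥ b x))))) := by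
  obtain ⟨V, hV, hVδ⟩ := exists_hasFDerivAt_inv_Pmat_mulVec hinv ha hb
  obtain ⟨W, hW, hWδ⟩ := exists_hasFDerivAt_Pmat_mulVec (T := T) hp hV
  obtain ⟨D, hD, hDδ⟩ := exists_hasFDerivAt_dotProduct hV hW
  refine ⟨D, hD, fun δ => ?_⟩
  rw [hDδ, hWδ, hVδ, dotProduct_add, dotProduct_comm _ (Pmat T (p x) *ᵥ _),
    ← dotProduct_mulVec_of_transpose_eq (Pmat_transpose hT2 (p x))]
  ring

end

/-- the compatibility identities `DH₁(U) = DE₁(U) ∘ J_F(U)` and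
`DK₁(U) = DE₁(U) ∘ J_G(U)` for the Fréchet derivatives, with the stated block
Jacobians acting on directions `δ = (δh, δqˣ, δqʸ)`. -/
theorem compatibility_identities {K : ℕ} (hK : 1 ≤ K) (T : Fin K → Fin K → Fin K → ℝ)
    (hT1 : ∀ k l m, T k l m = T l k m) (hT2 : ∀ k l m, T k l m = T k m l)
    (g : ℝ) (hg : 0 < g) (h qx qy : Fin K → ℝ) (hinv : IsUnit (Pmat T h)) :
    let Ph := Pmat T h
    let Pqx := Pmat T qx
    let Pqy := Pmat T qy
    let Pu := Pmat T (Ph⁻¹ *ᵥ qx)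
    let Pv := Pmat T (Ph⁻¹ *ᵥ qy)
    let JF : StateK K → StateK K := fun δ =>
      (δ.2.1,
       (g • Ph - Pqx * Ph⁻¹ * Pu) *ᵥ δ.1 + (Pqx * Ph⁻¹ + Pu) *ᵥ δ.2.1,
       -((Pqx * Ph⁻¹ * Pv) *ᵥ δ.1) + Pv *ᵥ δ.2.1 + (Pqx * Ph⁻¹) *ᵥ δ.2.2)
    let JG : StateK K → StateK K := fun δ =>
      (δ.2.2,
       -((Pqy * Ph⁻¹ * Pu) *ᵥ δ.1) + (Pqy * Ph⁻¹) *ᵥ δ.2.1 + Pu *ᵥ δ.2.2,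
       (g • Ph - Pqy * Ph⁻¹ * Pv) *ᵥ δ.1 + (Pqy * Ph⁻¹ + Pv) *ᵥ δ.2.2)
    ∃ (LE LH LK : StateK K →L[ℝ] ℝ),
      HasFDerivAt (E1 T g) LE (h, qx, qy) ∧
      HasFDerivAt (H1 T g) LH (h, qx, qy) ∧
      HasFDerivAt (K1 T g) LK (h, qx, qy) ∧
      (∀ δ : StateK K, LH δ = LE (JF δ)) ∧
      (∀ δ : StateK K, LK δ = LE (JG δ)) := by
  intro Ph Pqx Pqy Pu Pv JF JG
  have dh : HasFDerivAt (fun U : StateK K => U.1)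
      (ContinuousLinearMap.fst ℝ _ _) (h, qx, qy) := hasFDerivAt_fst
  have dq : HasFDerivAt (fun U : StateK K => U.2)
      (ContinuousLinearMap.snd ℝ _ _) (h, qx, qy) := hasFDerivAt_snd
  have dx := dq.fst
  have dy := dq.snd
  obtain ⟨Ex, hEx, hExδ⟩ := exists_hasFDerivAt_kinetic hT2 hinv dh dx
  obtain ⟨Ey, hEy, hEyδ⟩ := exists_hasFDerivAt_kinetic hT2 hinv dh dy
  obtain ⟨Eh, hEh, hEhδ⟩ := exists_hasFDerivAt_dotProduct dh dh
  obtain ⟨Hx, hHx, hHxδ⟩ := exists_hasFDerivAt_kinetic_flux hT2 hinv dh dx dx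
  obtain ⟨Hy, hHy, hHyδ⟩ := exists_hasFDerivAt_kinetic_flux hT2 hinv dh dy dx
  obtain ⟨Hh, hHh, hHhδ⟩ := exists_hasFDerivAt_dotProduct dx dh
  obtain ⟨Kx, hKx, hKxδ⟩ := exists_hasFDerivAt_kinetic_flux hT2 hinv dh dx dy
  obtain ⟨Ky, hKy, hKyδ⟩ := exists_hasFDerivAt_kinetic_flux hT2 hinv dh dy dy
  obtain ⟨Kh, hKh, hKhδ⟩ := exists_hasFDerivAt_dotProduct dy dh
  have hdet : IsUnit (Pmat T h).det := (isUnit_iff_isUnit_det _).mp hinv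
  have hgrav (q w : Fin K → ℝ) : ((Pmat T h)⁻¹ *ᵥ q) ⬝ᵥ (Pmat T h *ᵥ w) = q ⬝ᵥ w := by
    rw [dotProduct_mulVec_of_transpose_eq (Pmat_transpose hT2 h), mulVec_mulVec,
      mul_nonsing_inv _ hdet, one_mulVec]
  refine ⟨_, _, _, ((hEx.add hEy).const_mul (1 / 2)).add (hEh.const_mul (1 / 2 * g)),
    ((hHx.add hHy).const_mul (1 / 2)).add (hHh.const_mul g),
    ((hKx.add hKy).const_mul (1 / 2)).add (hKh.const_mul g), fun δ => ?_, fun δ => ?_⟩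
  · simp only [_root_.add_apply, _root_.smul_apply, smul_eq_mul,
      hExδ, hEyδ, hEhδ, hHxδ, hHyδ, hHhδ, ContinuousLinearMap.comp_apply,
      ContinuousLinearMap.coe_fst', ContinuousLinearMap.coe_snd']
    simp only [JF, Ph, Pu, Pv, Pqx, add_mulVec, sub_mulVec, smul_mulVec, mulVec_sub, dotProduct_add,
      dotProduct_sub, dotProduct_neg, dotProduct_smul, smul_eq_mul, hgrav, ← mulVec_mulVec,
      Pmat_mulVec_comm hT1 hT2 ((Pmat T h)⁻¹ *ᵥ qx),
      Pmat_mulVec_comm hT1 hT2 ((Pmat T h)⁻¹ *ᵥ qy)]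
    rw [dotProduct_comm h]
    ring
  · simp only [_root_.add_apply, _root_.smul_apply, smul_eq_mul,
      hExδ, hEyδ, hEhδ, hKxδ, hKyδ, hKhδ, ContinuousLinearMap.comp_apply,
      ContinuousLinearMap.coe_fst', ContinuousLinearMap.coe_snd']
    simp only [JG, Ph, Pu, Pv, Pqy, add_mulVec, sub_mulVec, smul_mulVec, mulVec_sub, dotProduct_add,
      dotProduct_sub, dotProduct_neg, dotProduct_smul, smul_eq_mul, hgrav, ← mulVec_mulVec,
      Pmat_mulVec_comm hT1 hT2 ((Pmat T h)⁻¹ *ᵥ qx),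
      Pmat_mulVec_comm hT1 hT2 ((Pmat T h)⁻¹ *ᵥ qy)]
    rw [dotProduct_comm h]
    ring
end

section
/- Fix g > 0 and let B : ℝ² → ℝ^K be continuously differentiable. Let (h, qˣ, qʸ) : ℝ² × (0, T) → ℝ^K × ℝ^K × ℝ^K be continuously differentiable with 𝒫(h(x,y,t)) invertible everywhere, and suppose it satisfies the stochastic Galerkin shallow water system: ∂ₜh + ∂ₓqˣ + ∂ᵧqʸ = 0; ∂ₜqˣ + ∂ₓ(𝒫(qˣ)𝒫(h)⁻¹qˣ + ½g𝒫(h)h) + ∂ᵧ(𝒫(qʸ)𝒫(h)⁻¹qˣ) = −g𝒫(h)∂ₓB; ∂ₜqʸ + ∂ₓ(𝒫(qˣ)𝒫(h)⁻¹qʸ) + ∂ᵧ(𝒫(qʸ)𝒫(h)⁻¹qʸ + ½g𝒫(h)h) = −g𝒫(h)∂ᵧB. Then, with u = 𝒫(h)⁻¹qˣ, v = 𝒫(h)⁻¹qʸ, E = ½(qˣ·u + qʸ·v) + ½g‖h‖² + g h·B, H = ½(uᵀ𝒫(qˣ)u + vᵀ𝒫(qˣ)v) + g qˣ·(h+B),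 and K = ½(uᵀ𝒫(qʸ)u + vᵀ𝒫(qʸ)v) + g qʸ·(h+B), the companion balance law ∂ₜE + ∂ₓH + ∂ᵧK = 0 holds pointwise on ℝ² × (0, T). -/
open Matrix

/-- The bilinear map `(a, b) ↦ 𝒫(a) b`. -/
noncomputable def pmatBilin {K : ℕ} (T : Fin K → Fin K → Fin K → ℝ) :
    (Fin K → ℝ) →ₗ[ℝ] (Fin K → ℝ) →ₗ[ℝ] (Fin K → ℝ) :=
  LinearMap.mk₂ ℝ (fun a b => Pmat T a *ᵥ b)
    (fun a a' b => by
      rw [← Matrix.add_mulVec]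
      congr 1
      ext l m
      simp [Pmat, add_mul, Finset.sum_add_distrib])
    (fun c a b => by
      rw [← Matrix.smul_mulVec]
      congr 1
      ext l m
      simp [Pmat, mul_assoc, Finset.mul_sum])
    (fun a b b' => Matrix.mulVec_add _ _ _)
    (fun c a b => Matrix.mulVec_smul _ _ _)

theorem pmatBilin_apply {K : ℕ} (T : Fin K → Fin K → Fin K → ℝ) (a b : Fin K → ℝ) :
    pmatBilin T a b = Pmat T a *ᵥ b := rfl

theorem pmat_add_mulVec {K : ℕ} (T : Fin K → Fin K → Fin K → ℝ) (a a' b : Fin K → ℝ) :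
    Pmat T (a + a') *ᵥ b = Pmat T a *ᵥ b + Pmat T a' *ᵥ b := by
  simp [← pmatBilin_apply]

theorem pmat_mulVec_comm {K : ℕ} {T : Fin K → Fin K → Fin K → ℝ}
    (hT1 : ∀ k l m, T k l m = T l k m) (hT2 : ∀ k l m, T k l m = T k m l)
    (a b : Fin K → ℝ) : Pmat T a *ᵥ b = Pmat T b *ᵥ a := by
  ext l
  simp only [Pmat, Matrix.mulVec, dotProduct, Matrix.of_apply, Finset.sum_mul]
  rw [Finset.sum_comm]
  refine Finset.sum_congr rfl fun k _ => Finset.sum_congr rfl fun m _ => ?_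
  rw [hT2 k l m, hT1 k m l, hT2 m k l]
  ring

theorem dotProduct_pmat_mulVec_comm {K : ℕ} {T : Fin K → Fin K → Fin K → ℝ}
    (hT2 : ∀ k l m, T k l m = T k m l) (a b c : Fin K → ℝ) :
    a ⬝ᵥ (Pmat T b *ᵥ c) = c ⬝ᵥ (Pmat T b *ᵥ a) := by
  have hsymm : (Pmat T b)ᵀ = Pmat T b := by
    ext l m
    simp only [Pmat, Matrix.transpose_apply, Matrix.of_apply]
    exact Finset.sum_congr rfl fun k _ => by rw [hT2]
  rw [Matrix.dotProduct_mulVec, ← Matrix.mulVec_transpose, hsymm, dotProduct_comm]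

section Calculus

variable {E : Type*} [NormedAddCommGroup E] [NormedSpace ℝ E] {K : ℕ}

theorem DifferentiableAt.pmat_mulVec (T : Fin K → Fin K → Fin K → ℝ)
    {f k : E → Fin K → ℝ} {p : E}
    (hf : DifferentiableAt ℝ f p) (hk : DifferentiableAt ℝ k p) :
    DifferentiableAt ℝ (fun x => Pmat T (f x) *ᵥ k x) p :=
  ((pmatBilin T).toContinuousBilinearMap.hasFDerivAt_of_bilinear
    hf.hasFDerivAt hk.hasFDerivAt).differentiableAt

theorem fderiv_pmat_mulVec (T : Fin K → Fin K → Fin K → ℝ)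
    {f k : E → Fin K → ℝ} {p : E}
    (hf : DifferentiableAt ℝ f p) (hk : DifferentiableAt ℝ k p) (d : E) :
    fderiv ℝ (fun x => Pmat T (f x) *ᵥ k x) p d
      = Pmat T (fderiv ℝ f p d) *ᵥ k p + Pmat T (f p) *ᵥ fderiv ℝ k p d := by
  have := ((pmatBilin T).toContinuousBilinearMap.hasFDerivAt_of_bilinear
    hf.hasFDerivAt hk.hasFDerivAt).fderiv
  refine (DFunLike.congr_fun this d).trans ?_
  rw [add_comm]
  rfl

theorem DifferentiableAt.dotProduct {f k : E → Fin K → ℝ} {p : E}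
    (hf : DifferentiableAt ℝ f p) (hk : DifferentiableAt ℝ k p) :
    DifferentiableAt ℝ (fun x => f x ⬝ᵥ k x) p :=
  ((dotProductBilin ℝ ℝ (m := Fin K) (A := ℝ)).toContinuousBilinearMap.hasFDerivAt_of_bilinear
    hf.hasFDerivAt hk.hasFDerivAt).differentiableAt

theorem fderiv_dotProduct {f k : E → Fin K → ℝ} {p : E}
    (hf : DifferentiableAt ℝ f p) (hk : DifferentiableAt ℝ k p) (d : E) :
    fderiv ℝ (fun x => f x ⬝ᵥ k x) p d
      = fderiv ℝ f p d ⬝ᵥ k p + f p ⬝ᵥ fderiv ℝ k p d := by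
  have := ((dotProductBilin ℝ ℝ (m := Fin K) (A := ℝ)).toContinuousBilinearMap.hasFDerivAt_of_bilinear
    hf.hasFDerivAt hk.hasFDerivAt).fderiv
  refine (DFunLike.congr_fun this d).trans ?_
  rw [add_comm]
  rfl

attribute [local instance] Matrix.linftyOpNormedRing Matrix.linftyOpNormedAlgebra in
theorem DifferentiableAt.pmat_inv_mulVec (T : Fin K → Fin K → Fin K → ℝ)
    {f k : E → Fin K → ℝ} {p : E}
    (hf : DifferentiableAt ℝ f p) (hk : DifferentiableAt ℝ k p)
    (hp : IsUnit (Pmat T (f p))) :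
    DifferentiableAt ℝ (fun x => (Pmat T (f x))⁻¹ *ᵥ k x) p := by
  have hP : DifferentiableAt ℝ (fun x => Pmat T (f x)) p := by
    let L : (Fin K → ℝ) →ₗ[ℝ] Matrix (Fin K) (Fin K) ℝ :=
      LinearMap.toMatrix'.toLinearMap ∘ₗ pmatBilin T
    have hL : ∀ a, L a = Pmat T a := fun a => LinearMap.toMatrix'_toLin' (Pmat T a)
    simp only [← hL]
    exact L.toContinuousLinearMap.differentiableAt.comp p hf
  have hI : DifferentiableAt ℝ (fun x => (Pmat T (f x))⁻¹) p := by
    obtain ⟨w, hw⟩ := hp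
    have := differentiableAt_inverse (𝕜 := ℝ) w.isUnit
    rw [hw] at this
    simp only [Matrix.nonsing_inv_eq_ringInverse]
    exact this.comp p hP
  exact ((Matrix.mulVecBilin ℝ ℝ).toContinuousBilinearMap.hasFDerivAt_of_bilinear
    hI.hasFDerivAt hk.hasFDerivAt).differentiableAt

end Calculus

/-- The algebraic identity behind the companion balance law; a name such as `qxt` stands for the
value of `∂ₜqˣ`. -/
theorem companion_balance_algebra {K : ℕ} {T : Fin K → Fin K → Fin K → ℝ}
    (hT1 : ∀ k l m, T k l m = T l k m) (hT2 : ∀ k l m, T k l m = T k m l) (g : ℝ)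
    {h qx qy u v b ht hx hy qxt qxx qyt qyy ut ux uy vt vx vy bx b_y : Fin K → ℝ}
    (hu : qx = Pmat T h *ᵥ u) (hv : qy = Pmat T h *ᵥ v)
    (hxt : qxt = Pmat T ht *ᵥ u + Pmat T h *ᵥ ut)
    (hyt : qyt = Pmat T ht *ᵥ v + Pmat T h *ᵥ vt)
    (pde_h : ht + qxx + qyy = 0)
    (pde_qx : qxt + (Pmat T qxx *ᵥ u + Pmat T qx *ᵥ ux
        + ((1 / 2) * g) • (Pmat T hx *ᵥ h + Pmat T h *ᵥ hx))
        + (Pmat T qyy *ᵥ u + Pmat T qy *ᵥ uy) = -g • (Pmat T h *ᵥ bx))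
    (pde_qy : qyt + (Pmat T qxx *ᵥ v + Pmat T qx *ᵥ vx)
        + (Pmat T qyy *ᵥ v + Pmat T qy *ᵥ vy
        + ((1 / 2) * g) • (Pmat T hy *ᵥ h + Pmat T h *ᵥ hy)) = -g • (Pmat T h *ᵥ b_y)) :
    (1 / 2) * (qxt ⬝ᵥ u + qx ⬝ᵥ ut + (qyt ⬝ᵥ v + qy ⬝ᵥ vt))
        + (1 / 2) * g * (ht ⬝ᵥ h + h ⬝ᵥ ht) + g * (ht ⬝ᵥ b + h ⬝ᵥ 0)
      + ((1 / 2) * (ux ⬝ᵥ (Pmat T qx *ᵥ u) + u ⬝ᵥ (Pmat T qxx *ᵥ u + Pmat T qx *ᵥ ux)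
          + (vx ⬝ᵥ (Pmat T qx *ᵥ v) + v ⬝ᵥ (Pmat T qxx *ᵥ v + Pmat T qx *ᵥ vx)))
        + g * (qxx ⬝ᵥ (h + b) + qx ⬝ᵥ (hx + bx)))
      + ((1 / 2) * (uy ⬝ᵥ (Pmat T qy *ᵥ u) + u ⬝ᵥ (Pmat T qyy *ᵥ u + Pmat T qy *ᵥ uy)
          + (vy ⬝ᵥ (Pmat T qy *ᵥ v) + v ⬝ᵥ (Pmat T qyy *ᵥ v + Pmat T qy *ᵥ vy)))
        + g * (qyy ⬝ᵥ (h + b) + qy ⬝ᵥ (hy + b_y))) = 0 := by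
  have swap := dotProduct_pmat_mulVec_comm hT2
  have hux : qx ⬝ᵥ hx = u ⬝ᵥ (Pmat T h *ᵥ hx) := by rw [hu, dotProduct_comm, swap]
  have hub : qx ⬝ᵥ bx = u ⬝ᵥ (Pmat T h *ᵥ bx) := by rw [hu, dotProduct_comm, swap]
  have hvy : qy ⬝ᵥ hy = v ⬝ᵥ (Pmat T h *ᵥ hy) := by rw [hv, dotProduct_comm, swap]
  have hvb : qy ⬝ᵥ b_y = v ⬝ᵥ (Pmat T h *ᵥ b_y) := by rw [hv, dotProduct_comm, swap]
  have hut : qx ⬝ᵥ ut = u ⬝ᵥ (Pmat T h *ᵥ ut) := by rw [hu, dotProduct_comm, swap]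
  have hvt : qy ⬝ᵥ vt = v ⬝ᵥ (Pmat T h *ᵥ vt) := by rw [hv, dotProduct_comm, swap]
  have mu := congrArg (u ⬝ᵥ ·) pde_qx
  have mv := congrArg (v ⬝ᵥ ·) pde_qy
  have xu := congrArg (u ⬝ᵥ ·) hxt
  have yv := congrArg (v ⬝ᵥ ·) hyt
  have cu := congrArg (fun w => u ⬝ᵥ (Pmat T w *ᵥ u)) pde_h
  have cv := congrArg (fun w => v ⬝ᵥ (Pmat T w *ᵥ v)) pde_h
  have ch := congrArg (fun w => w ⬝ᵥ (h + b)) pde_h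
  have zero_mulVec : ∀ w, Pmat T 0 *ᵥ w = 0 := fun w => by simp [← pmatBilin_apply]
  simp only [pmat_mulVec_comm hT1 hT2 hx h, pmat_mulVec_comm hT1 hT2 hy h, dotProduct_add,
    add_dotProduct, dotProduct_smul, smul_eq_mul, pmat_add_mulVec, zero_mulVec,
    dotProduct_zero, zero_dotProduct] at mu mv xu yv cu cv ch ⊢
  rw [hux, hub, hvy, hvb, hut, hvt, swap ux, swap uy, swap vx, swap vy, dotProduct_comm qxt,
    dotProduct_comm qyt, dotProduct_comm h ht]
  linear_combination mu + mv - (1 / 2) * xu - (1 / 2) * yv - (1 / 2) * cu - (1 / 2) * cv + g * ch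

/-- The companion balance law at a point, for solutions written in terms of velocities `u`, `v`
with `qx = 𝒫(h) u` and `qy = 𝒫(h) v` near that point. -/
theorem companion_balance_of_velocities {K : ℕ} {T : Fin K → Fin K → Fin K → ℝ}
    (hT1 : ∀ k l m, T k l m = T l k m) (hT2 : ∀ k l m, T k l m = T k m l)
    (g : ℝ) {B : ℝ × ℝ → (Fin K → ℝ)} {h qx qy u v : ℝ × ℝ × ℝ → (Fin K → ℝ)} {p : ℝ × ℝ × ℝ}
    (hB : DifferentiableAt ℝ B (p.1, p.2.1))
    (dh : DifferentiableAt ℝ h p) (dx : DifferentiableAt ℝ qx p) (dy : DifferentiableAt ℝ qy p)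
    (du : DifferentiableAt ℝ u p) (dv : DifferentiableAt ℝ v p)
    (hu : ∀ᶠ x in nhds p, qx x = Pmat T (h x) *ᵥ u x)
    (hv : ∀ᶠ x in nhds p, qy x = Pmat T (h x) *ᵥ v x)
    (pde_h : fderiv ℝ h p ((0 : ℝ), (0 : ℝ), (1 : ℝ))
        + fderiv ℝ qx p ((1 : ℝ), (0 : ℝ), (0 : ℝ))
        + fderiv ℝ qy p ((0 : ℝ), (1 : ℝ), (0 : ℝ)) = 0)
    (pde_qx : fderiv ℝ qx p ((0 : ℝ), (0 : ℝ), (1 : ℝ))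
        + fderiv ℝ (fun p' => Pmat T (qx p') *ᵥ u p'
            + ((1 / 2) * g) • (Pmat T (h p') *ᵥ h p')) p ((1 : ℝ), (0 : ℝ), (0 : ℝ))
        + fderiv ℝ (fun p' => Pmat T (qy p') *ᵥ u p') p ((0 : ℝ), (1 : ℝ), (0 : ℝ))
      = -g • (Pmat T (h p) *ᵥ fderiv ℝ B (p.1, p.2.1) ((1 : ℝ), (0 : ℝ))))
    (pde_qy : fderiv ℝ qy p ((0 : ℝ), (0 : ℝ), (1 : ℝ))
        + fderiv ℝ (fun p' => Pmat T (qx p') *ᵥ v p') p ((1 : ℝ), (0 : ℝ), (0 : ℝ))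
        + fderiv ℝ (fun p' => Pmat T (qy p') *ᵥ v p'
            + ((1 / 2) * g) • (Pmat T (h p') *ᵥ h p')) p ((0 : ℝ), (1 : ℝ), (0 : ℝ))
      = -g • (Pmat T (h p) *ᵥ fderiv ℝ B (p.1, p.2.1) ((0 : ℝ), (1 : ℝ)))) :
    fderiv ℝ (fun p' => (1 / 2) * (qx p' ⬝ᵥ u p' + qy p' ⬝ᵥ v p')
            + (1 / 2) * g * (h p' ⬝ᵥ h p') + g * (h p' ⬝ᵥ B (p'.1, p'.2.1)))
          p ((0 : ℝ), (0 : ℝ), (1 : ℝ))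
      + fderiv ℝ (fun p' =>
          (1 / 2) * (u p' ⬝ᵥ (Pmat T (qx p') *ᵥ u p') + v p' ⬝ᵥ (Pmat T (qx p') *ᵥ v p'))
            + g * (qx p' ⬝ᵥ (h p' + B (p'.1, p'.2.1))))
          p ((1 : ℝ), (0 : ℝ), (0 : ℝ))
      + fderiv ℝ (fun p' =>
          (1 / 2) * (u p' ⬝ᵥ (Pmat T (qy p') *ᵥ u p') + v p' ⬝ᵥ (Pmat T (qy p') *ᵥ v p'))
            + g * (qy p' ⬝ᵥ (h p' + B (p'.1, p'.2.1))))
          p ((0 : ℝ), (1 : ℝ), (0 : ℝ))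
      = 0 := by
  have hBp : HasFDerivAt (fun p' : ℝ × ℝ × ℝ => B (p'.1, p'.2.1)) _ p :=
    HasFDerivAt.comp p hB.hasFDerivAt
      (hasFDerivAt_fst.prodMk (hasFDerivAt_fst.comp p hasFDerivAt_snd))
  have dB := hBp.differentiableAt
  have eB : ∀ d : ℝ × ℝ × ℝ, fderiv ℝ (fun p' : ℝ × ℝ × ℝ => B (p'.1, p'.2.1)) p d
      = fderiv ℝ B (p.1, p.2.1) (d.1, d.2.1) := fun d => by
    rw [hBp.fderiv]
    rfl
  have hxt := fderiv_pmat_mulVec T dh du ((0 : ℝ), (0 : ℝ), (1 : ℝ))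
  rw [← Filter.EventuallyEq.fderiv_eq hu] at hxt
  have hyt := fderiv_pmat_mulVec T dh dv ((0 : ℝ), (0 : ℝ), (1 : ℝ))
  rw [← Filter.EventuallyEq.fderiv_eq hv] at hyt
  have hup := hu.self_of_nhds
  have hvp := hv.self_of_nhds
  have dxu := dx.pmat_mulVec T du
  have dxv := dx.pmat_mulVec T dv
  have dyu := dy.pmat_mulVec T du
  have dyv := dy.pmat_mulVec T dv
  have dhh := (dh.pmat_mulVec T dh).fun_const_smul ((1 / 2) * g)
  have dhB := dh.fun_add dB
  have dxu' := du.dotProduct dxu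
  have dxv' := dv.dotProduct dxv
  have dyu' := du.dotProduct dyu
  have dyv' := dv.dotProduct dyv
  have dqu := dx.dotProduct du
  have dqv := dy.dotProduct dv
  have dhh' := dh.dotProduct dh
  have dhB' := dh.dotProduct dB
  have dxB := dx.dotProduct dhB
  have dyB := dy.dotProduct dhB
  rw [fderiv_fun_add dxu dhh, fderiv_fun_const_smul (dh.pmat_mulVec T dh)] at pde_qx
  rw [fderiv_fun_add dyv dhh, fderiv_fun_const_smul (dh.pmat_mulVec T dh)] at pde_qy
  simp only [_root_.add_apply, _root_.smul_apply, fderiv_pmat_mulVec T dx du,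
    fderiv_pmat_mulVec T dx dv, fderiv_pmat_mulVec T dy du, fderiv_pmat_mulVec T dy dv,
    fderiv_pmat_mulVec T dh dh] at pde_qx pde_qy
  rw [fderiv_fun_add (((dqu.fun_add dqv).const_mul _).fun_add (dhh'.const_mul _))
      (dhB'.const_mul _),
    fderiv_fun_add ((dqu.fun_add dqv).const_mul _) (dhh'.const_mul _),
    fderiv_fun_add ((dxu'.fun_add dxv').const_mul _) (dxB.const_mul _),
    fderiv_fun_add ((dyu'.fun_add dyv').const_mul _) (dyB.const_mul _),
    fderiv_const_mul (dqu.fun_add dqv), fderiv_const_mul dhh', fderiv_const_mul dhB',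
    fderiv_const_mul (dxu'.fun_add dxv'), fderiv_const_mul dxB,
    fderiv_const_mul (dyu'.fun_add dyv'), fderiv_const_mul dyB,
    fderiv_fun_add dqu dqv, fderiv_fun_add dxu' dxv', fderiv_fun_add dyu' dyv']
  simp only [_root_.add_apply, _root_.smul_apply, smul_eq_mul, fderiv_dotProduct dx du,
    fderiv_dotProduct dy dv, fderiv_dotProduct dh dh, fderiv_dotProduct dh dB,
    fderiv_dotProduct dx dhB, fderiv_dotProduct dy dhB, fderiv_dotProduct du dxu,
    fderiv_dotProduct dv dxv, fderiv_dotProduct du dyu, fderiv_dotProduct dv dyv,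
    fderiv_pmat_mulVec T dx du, fderiv_pmat_mulVec T dx dv, fderiv_pmat_mulVec T dy du,
    fderiv_pmat_mulVec T dy dv, fderiv_fun_add dh dB, eB]
  have hB0 : fderiv ℝ B (p.1, p.2.1) ((0 : ℝ), (0 : ℝ)) = 0 := map_zero _
  rw [hB0]
  exact companion_balance_algebra hT1 hT2 g hup hvp hxt hyt pde_h pde_qx pde_qy

/-- smooth solutions of the 2D stochastic Galerkin shallow water system
satisfy the companion balance law `∂ₜE + ∂ₓH + ∂ᵧK = 0` pointwise on `ℝ² × (0, T)`.
Points `p : ℝ × ℝ × ℝ` are `(x, y, t)`, and partial derivatives are directional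
Fréchet derivatives along `(1,0,0)`, `(0,1,0)`, `(0,0,1)`. -/
theorem sg_companion_balance_law {K : ℕ} (hK : 1 ≤ K)
    (T : Fin K → Fin K → Fin K → ℝ)
    (hT1 : ∀ k l m, T k l m = T l k m) (hT2 : ∀ k l m, T k l m = T k m l)
    (g : ℝ) (hg : 0 < g) (Tend : ℝ)
    (B : ℝ × ℝ → (Fin K → ℝ)) (hB : ContDiff ℝ 1 B)
    (h qx qy : ℝ × ℝ × ℝ → (Fin K → ℝ))
    (hch : ContDiffOn ℝ 1 h {p : ℝ × ℝ × ℝ | p.2.2 ∈ Set.Ioo 0 Tend})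
    (hcx : ContDiffOn ℝ 1 qx {p : ℝ × ℝ × ℝ | p.2.2 ∈ Set.Ioo 0 Tend})
    (hcy : ContDiffOn ℝ 1 qy {p : ℝ × ℝ × ℝ | p.2.2 ∈ Set.Ioo 0 Tend})
    (hinv : ∀ p : ℝ × ℝ × ℝ, p.2.2 ∈ Set.Ioo 0 Tend → IsUnit (Pmat T (h p)))
    (pde_h : ∀ p : ℝ × ℝ × ℝ, p.2.2 ∈ Set.Ioo 0 Tend →
      fderiv ℝ h p ((0 : ℝ), (0 : ℝ), (1 : ℝ))
        + fderiv ℝ qx p ((1 : ℝ), (0 : ℝ), (0 : ℝ))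
        + fderiv ℝ qy p ((0 : ℝ), (1 : ℝ), (0 : ℝ)) = 0)
    (pde_qx : ∀ p : ℝ × ℝ × ℝ, p.2.2 ∈ Set.Ioo 0 Tend →
      fderiv ℝ qx p ((0 : ℝ), (0 : ℝ), (1 : ℝ))
        + fderiv ℝ (fun p' => Pmat T (qx p') *ᵥ ((Pmat T (h p'))⁻¹ *ᵥ qx p')
            + ((1 / 2) * g) • (Pmat T (h p') *ᵥ h p')) p ((1 : ℝ), (0 : ℝ), (0 : ℝ))
        + fderiv ℝ (fun p' => Pmat T (qy p') *ᵥ ((Pmat T (h p'))⁻¹ *ᵥ qx p')) p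
            ((0 : ℝ), (1 : ℝ), (0 : ℝ))
      = -g • (Pmat T (h p) *ᵥ fderiv ℝ B (p.1, p.2.1) ((1 : ℝ), (0 : ℝ))))
    (pde_qy : ∀ p : ℝ × ℝ × ℝ, p.2.2 ∈ Set.Ioo 0 Tend →
      fderiv ℝ qy p ((0 : ℝ), (0 : ℝ), (1 : ℝ))
        + fderiv ℝ (fun p' => Pmat T (qx p') *ᵥ ((Pmat T (h p'))⁻¹ *ᵥ qy p')) p
            ((1 : ℝ), (0 : ℝ), (0 : ℝ))
        + fderiv ℝ (fun p' => Pmat T (qy p') *ᵥ ((Pmat T (h p'))⁻¹ *ᵥ qy p')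
            + ((1 / 2) * g) • (Pmat T (h p') *ᵥ h p')) p ((0 : ℝ), (1 : ℝ), (0 : ℝ))
      = -g • (Pmat T (h p) *ᵥ fderiv ℝ B (p.1, p.2.1) ((0 : ℝ), (1 : ℝ)))) :
    ∀ p : ℝ × ℝ × ℝ, p.2.2 ∈ Set.Ioo 0 Tend →
      fderiv ℝ (fun p' =>
          (1 / 2) * (qx p' ⬝ᵥ ((Pmat T (h p'))⁻¹ *ᵥ qx p')
              + qy p' ⬝ᵥ ((Pmat T (h p'))⁻¹ *ᵥ qy p'))
            + (1 / 2) * g * (h p' ⬝ᵥ h p') + g * (h p' ⬝ᵥ B (p'.1, p'.2.1)))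
          p ((0 : ℝ), (0 : ℝ), (1 : ℝ))
      + fderiv ℝ (fun p' =>
          (1 / 2) * (((Pmat T (h p'))⁻¹ *ᵥ qx p')
                ⬝ᵥ (Pmat T (qx p') *ᵥ ((Pmat T (h p'))⁻¹ *ᵥ qx p'))
              + ((Pmat T (h p'))⁻¹ *ᵥ qy p')
                ⬝ᵥ (Pmat T (qx p') *ᵥ ((Pmat T (h p'))⁻¹ *ᵥ qy p')))
            + g * (qx p' ⬝ᵥ (h p' + B (p'.1, p'.2.1))))
          p ((1 : ℝ), (0 : ℝ), (0 : ℝ))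
      + fderiv ℝ (fun p' =>
          (1 / 2) * (((Pmat T (h p'))⁻¹ *ᵥ qx p')
                ⬝ᵥ (Pmat T (qy p') *ᵥ ((Pmat T (h p'))⁻¹ *ᵥ qx p'))
              + ((Pmat T (h p'))⁻¹ *ᵥ qy p')
                ⬝ᵥ (Pmat T (qy p') *ᵥ ((Pmat T (h p'))⁻¹ *ᵥ qy p')))
            + g * (qy p' ⬝ᵥ (h p' + B (p'.1, p'.2.1))))
          p ((0 : ℝ), (1 : ℝ), (0 : ℝ))
      = 0 := by
  intro p hp
  have hopen : IsOpen {p : ℝ × ℝ × ℝ | p.2.2 ∈ Set.Ioo 0 Tend} :=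
    isOpen_Ioo.preimage (continuous_snd.comp continuous_snd)
  have hmem := hopen.mem_nhds hp
  have dh := (hch.contDiffAt hmem).differentiableAt one_ne_zero
  have dx := (hcx.contDiffAt hmem).differentiableAt one_ne_zero
  have dy := (hcy.contDiffAt hmem).differentiableAt one_ne_zero
  have hcancel : ∀ q : ℝ × ℝ × ℝ → (Fin K → ℝ), ∀ᶠ x in nhds p,
      q x = Pmat T (h x) *ᵥ ((Pmat T (h x))⁻¹ *ᵥ q x) := fun q => by
    filter_upwards [hmem] with x hx
    rw [Matrix.mulVec_mulVec, Matrix.mul_nonsing_inv _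
      ((Matrix.isUnit_iff_isUnit_det _).mp (hinv x hx)), Matrix.one_mulVec]
  exact companion_balance_of_velocities hT1 hT2 g
    (hB.differentiable one_ne_zero).differentiableAt dh dx dy
    (dh.pmat_inv_mulVec T dx (hinv p hp)) (dh.pmat_inv_mulVec T dy (hinv p hp))
    (hcancel qx) (hcancel qy) (pde_h p hp) (pde_qx p hp) (pde_qy p hp)
end
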